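/- Let E = (E^0, E^1, r, s) be a topological graph. Then E is topologically free (the set of base points of cycles without entrances has empty interior in E^0) if and only if E is essentially free (i.e., the set of boundary paths μ ∈ ∂E such that the iterates μ, σ(μ), σ²(μ), … — for as long as they are defined — are pairwise distinct, equivalently the set of units of the boundary path groupoid Γ(∂E, σ) with trivial isotropy, is dense in ∂E). -/

import Mathlib

/-- A locally compact Hausdorff space is *totally disconnected* (in the sense used for
topological graphs) if it has an open base consisting of compact open subsets. -/
def TotallyDisc (T : Type) [TopologicalSpace T] : Prop :=
  ∀ (t : T) (U : Set T), IsOpen U → t ∈ U →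
    ∃ W : Set T, IsCompact W ∧ IsOpen W ∧ t ∈ W ∧ W ⊆ U

/-- A topological graph `E = (E⁰, E¹, r, s)`: `r` continuous, `s` a local homeomorphism. -/
structure TopGraph (V E : Type) [TopologicalSpace V] [TopologicalSpace E] where
  r : E → V
  s : E → V
  cont_r : Continuous r
  locHomeo_s : IsLocalHomeomorph s

namespace TopGraph

variable {V E : Type} [TopologicalSpace V] [TopologicalSpace E] (G : TopGraph V E)

/-- Compatibility condition for a finite sequence of edges to be a path. -/
def PathCond (n : ℕ) (μ : Fin n → E) : Prop :=
  ∀ (i : ℕ) (h : i + 1 < n), G.s (μ ⟨i, Nat.lt_of_succ_lt h⟩) = G.r (μ ⟨i + 1, h⟩)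

/-- The space `Eⁿ` of paths of length `n`; paths of length `0` are vertices. -/
def PathN : ℕ → Type
  | 0 => V
  | n + 1 => { μ : Fin (n + 1) → E // G.PathCond (n + 1) μ }

instance pathNTop : (n : ℕ) → TopologicalSpace (G.PathN n)
  | 0 => inferInstanceAs (TopologicalSpace V)
  | n + 1 => inferInstanceAs (TopologicalSpace { μ : Fin (n + 1) → E // G.PathCond (n + 1) μ })

/-- The finite path space `E* = ⨿ₙ Eⁿ` with the disjoint union topology. -/
def FinPath : Type := (n : ℕ) × G.PathN n

instance : TopologicalSpace G.FinPath := inferInstanceAs (TopologicalSpace ((n : ℕ) × G.PathN n))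

/-- The range `r(μ)` of a finite path. -/
def pathRange : (n : ℕ) → G.PathN n → V
  | 0, v => v
  | _ + 1, μ => G.r (μ.1 ⟨0, Nat.succ_pos _⟩)

/-- The source `s(μ)` of a finite path. -/
def pathSource : (n : ℕ) → G.PathN n → V
  | 0, v => v
  | n + 1, μ => G.s (μ.1 ⟨n, Nat.lt_succ_self n⟩)

/-- The `i`-th edge of a finite path (`none` if out of range); `0`-indexed. -/
def pathEdge : (n : ℕ) → G.PathN n → ℕ → Option E
  | 0, _, _ => none
  | n + 1, μ, i => if h : i < n + 1 then some (μ.1 ⟨i, h⟩) else none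

/-- `E⁰_sce = E⁰ \ cl (r(E¹))`. -/
def sce : Set V := {v | v ∉ closure (Set.range G.r)}

/-- `E⁰_fin`: vertices with an open neighborhood `N` such that `r⁻¹(cl N)` is compact. -/
def finV : Set V := {v | ∃ N : Set V, IsOpen N ∧ v ∈ N ∧ IsCompact (G.r ⁻¹' closure N)}

/-- `E⁰_rg = E⁰_fin \ cl (E⁰_sce)`. -/
def rg : Set V := G.finV \ closure G.sce

/-- `E⁰_sg = E⁰ \ E⁰_rg`. -/
def sg : Set V := {v | v ∉ G.rg}

/-- The infinite path space `E^∞`. -/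
def InfPath : Type := { μ : ℕ → E // ∀ i : ℕ, G.s (μ i) = G.r (μ (i + 1)) }

/-- The boundary path space `∂E = E^∞ ⨿ {μ ∈ E* : s(μ) ∈ E⁰_sg}`. -/
def BoundaryPath : Type :=
  G.InfPath ⊕ { α : G.FinPath // G.pathSource α.1 α.2 ∈ G.sg }

/-- The finite boundary path determined by a finite path whose source is singular. -/
def mkFin (α : G.FinPath) (h : G.pathSource α.1 α.2 ∈ G.sg) : G.BoundaryPath :=
  Sum.inr ⟨α, h⟩

/-- The length of a boundary path, in `ℕ∞`. -/
def bLen : G.BoundaryPath → ℕ∞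
  | Sum.inl _ => ⊤
  | Sum.inr α => (α.1.1 : ℕ∞)

/-- The `i`-th edge of a boundary path. -/
def bEdge : G.BoundaryPath → ℕ → Option E
  | Sum.inl μ, i => some (μ.1 i)
  | Sum.inr α, i => G.pathEdge α.1.1 α.1.2 i

/-- The range vertex of a boundary path. -/
def bRange : G.BoundaryPath → V
  | Sum.inl μ => G.r (μ.1 0)
  | Sum.inr α => G.pathRange α.1.1 α.1.2

/-- `α ∈ E*` is an initial segment of the boundary path `μ`, i.e. `μ = αβ`. -/
def IsPrefix (α : G.FinPath) (μ : G.BoundaryPath) : Prop :=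
  G.pathRange α.1 α.2 = G.bRange μ ∧
    ∀ i : ℕ, i < α.1 → G.bEdge μ i = G.pathEdge α.1 α.2 i

/-- The cylinder set `Z(S) ⊆ ∂E` of a set `S ⊆ E*`. -/
def cyl (S : Set G.FinPath) : Set G.BoundaryPath :=
  {μ | ∃ α ∈ S, G.IsPrefix α μ}

/-- The topology on `∂E`, generated by the sets `Z(U) ∩ Z(K)ᶜ` with `U` open, `K` compact. -/
instance : TopologicalSpace G.BoundaryPath :=
  TopologicalSpace.generateFrom
    {W | ∃ (U K : Set G.FinPath), IsOpen U ∧ IsCompact K ∧ W = G.cyl U ∩ (G.cyl K)ᶜ}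

/-- Removing the first edge of a path of length `n + 1`. -/
def pathTail : (n : ℕ) → G.PathN (n + 1) → G.PathN n
  | 0, μ => G.s (μ.1 ⟨0, Nat.one_pos⟩)
  | n + 1, μ => ⟨fun i => μ.1 ⟨i.1 + 1, by omega⟩, fun i h => μ.2 (i + 1) (by omega)⟩

theorem pathSource_pathTail : ∀ (n : ℕ) (μ : G.PathN (n + 1)),
    G.pathSource n (G.pathTail n μ) = G.pathSource (n + 1) μ
  | 0, μ => rfl
  | n + 1, μ => rfl

/-- The one-sided shift `σ` on `∂E` (the identity on paths of length `0`,
where it is undefined). -/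
def shift : G.BoundaryPath → G.BoundaryPath
  | Sum.inl μ => Sum.inl ⟨fun i => μ.1 (i + 1), fun i => μ.2 (i + 1)⟩
  | Sum.inr α =>
    match α with
    | ⟨⟨0, v⟩, h⟩ => Sum.inr ⟨⟨0, v⟩, h⟩
    | ⟨⟨n + 1, μ⟩, h⟩ =>
        Sum.inr ⟨⟨n, G.pathTail n μ⟩, by rw [G.pathSource_pathTail]; exact h⟩

/-- The Renault–Deaconu relation of the boundary path groupoid `Γ(∂E, σ)`:
`(μ, n, ν)` is an element of the groupoid. -/
def bRD (μ : G.BoundaryPath) (n : ℤ) (ν : G.BoundaryPath) : Prop :=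
  ∃ k l : ℕ, n = (k : ℤ) - (l : ℤ) ∧ (k : ℕ∞) ≤ G.bLen μ ∧ (l : ℕ∞) ≤ G.bLen ν ∧
    G.shift^[k] μ = G.shift^[l] ν

/-- The boundary path groupoid `Γ(∂E, σ)` as a set of triples. -/
def BPGroupoid : Type :=
  { x : G.BoundaryPath × ℤ × G.BoundaryPath // G.bRD x.1 x.2.1 x.2.2 }

/-- The range map of the boundary path groupoid. -/
def gR (x : G.BPGroupoid) : G.BoundaryPath := x.1.1

/-- The source map of the boundary path groupoid. -/
def gS (x : G.BPGroupoid) : G.BoundaryPath := x.1.2.2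

/-- The topology on `Γ(∂E, σ)` generated by the basic open sets `𝒰(U, V, k, l)`. -/
instance : TopologicalSpace G.BPGroupoid :=
  TopologicalSpace.generateFrom
    {W | ∃ (U Vs : Set G.BoundaryPath) (k l : ℕ),
      IsOpen U ∧ IsOpen Vs ∧
      (∀ μ ∈ U, (k : ℕ∞) ≤ G.bLen μ) ∧ (∀ μ ∈ Vs, (l : ℕ∞) ≤ G.bLen μ) ∧
      Set.InjOn (G.shift^[k]) U ∧ Set.InjOn (G.shift^[l]) Vs ∧
      W = {x : G.BPGroupoid | G.gR x ∈ U ∧ G.gS x ∈ Vs ∧ x.1.2.1 = (k : ℤ) - (l : ℤ) ∧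
        G.shift^[k] (G.gR x) = G.shift^[l] (G.gS x)}}

/-- A unit `μ ∈ ∂E` has trivial isotropy in `Γ(∂E, σ)`. -/
def TrivialIsotropy (μ : G.BoundaryPath) : Prop :=
  ∀ n : ℤ, G.bRD μ n μ → n = 0

/-- `E` is essentially free: the units with trivial isotropy are dense in `∂E`. -/
def EssentiallyFree : Prop := Dense {μ : G.BoundaryPath | G.TrivialIsotropy μ}

/-- `N ⊆ Γ(∂E, σ)` is a bisection: the source and range maps restrict to homeomorphisms
of `N` onto their images. -/
def IsBisection (N : Set G.BPGroupoid) : Prop :=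
  Topology.IsEmbedding (N.restrict G.gS) ∧ Topology.IsEmbedding (N.restrict G.gR)

/-- The boundary path groupoid `Γ(∂E, σ)` is locally contracting
(Anantharaman-Delaroche): for every nonempty open `U` in the unit space `∂E` there are an
open `V ⊆ U` and an open bisection `N` with `cl V ⊆ s(N)` and
`s((r|_{N⁻¹})⁻¹(cl V)) ⊊ V`. -/
def BPLocallyContracting : Prop :=
  ∀ U : Set G.BoundaryPath, IsOpen U → U.Nonempty →
    ∃ (Vs : Set G.BoundaryPath) (N : Set G.BPGroupoid),
      IsOpen Vs ∧ Vs ⊆ U ∧ IsOpen N ∧ G.IsBisection N ∧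
      closure Vs ⊆ G.gS '' N ∧
      G.gR '' (N ∩ {x | G.gS x ∈ closure Vs}) ⊂ Vs

/-- `μ` is a cycle: a path of length `n + 1 ≥ 1` with `r(μ) = s(μ)`. -/
def IsCycle (n : ℕ) (μ : G.PathN (n + 1)) : Prop :=
  G.pathRange (n + 1) μ = G.pathSource (n + 1) μ

/-- The cycle `μ` has no entrances: `r⁻¹(r(μᵢ)) = {μᵢ}` for all `i`. -/
def NoEntrances (n : ℕ) (μ : G.PathN (n + 1)) : Prop :=
  ∀ (i : Fin (n + 1)) (e : E), G.r e = G.r (μ.1 i) → e = μ.1 i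

/-- The cycle `μ` has entrances. -/
def HasEntrances (n : ℕ) (μ : G.PathN (n + 1)) : Prop := ¬ G.NoEntrances n μ

/-- `E` is topologically free: the set of base points of cycles without entrances has
empty interior. -/
def TopologicallyFree : Prop :=
  interior {v : V | ∃ (n : ℕ) (μ : G.PathN (n + 1)),
    G.IsCycle n μ ∧ G.NoEntrances n μ ∧ G.pathRange (n + 1) μ = v} = ∅

/-- The positive orbit space `Orb⁺(v)` of a vertex. -/
def orb (v : V) : Set V :=
  {w | ∃ (n : ℕ) (ν : G.PathN n), G.pathRange n ν = w ∧ G.pathSource n ν = v}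

/-- `Orb⁺(r(μ)) ∪ ⋃ᵢ Orb⁺(s(μᵢ))` for a boundary path `μ`. -/
def cofinalSet (μ : G.BoundaryPath) : Set V :=
  G.orb (G.bRange μ) ∪ {w | ∃ (i : ℕ) (e : E), G.bEdge μ i = some e ∧ w ∈ G.orb (G.s e)}

/-- `E` is cofinal. -/
def Cofinal : Prop := ∀ μ : G.BoundaryPath, Dense (G.cofinalSet μ)

/-- Every open neighborhood `N` of `μ` in `E^{|μ|}` contains an open neighborhood `U` of
`μ` with `r^{|μ|}(U) ⊆ s^{|μ|}(U)`. -/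
def NbhdContracting (n : ℕ) (μ : G.PathN (n + 1)) : Prop :=
  ∀ N : Set (G.PathN (n + 1)), IsOpen N → μ ∈ N →
    ∃ U : Set (G.PathN (n + 1)), IsOpen U ∧ μ ∈ U ∧ U ⊆ N ∧
      G.pathRange (n + 1) '' U ⊆ G.pathSource (n + 1) '' U

/-- The set `B` of vertices which connect to a cycle `μ` with entrances such that every
open neighborhood of `μ` contains an open neighborhood `U` of `μ` with
`r^{|μ|}(U) ⊆ s^{|μ|}(U)`. -/
def Bset : Set V :=
  {v | ∃ (n : ℕ) (μ : G.PathN (n + 1)), G.IsCycle n μ ∧ G.HasEntrances n μ ∧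
    v ∈ G.orb (G.pathRange (n + 1) μ) ∧ G.NbhdContracting n μ}

/-- Truncation of a path of length `n + 1` to its first `m + 1` edges (`m ≤ n`). -/
def pathTrunc (m n : ℕ) (h : m ≤ n) (μ : G.PathN (n + 1)) : G.PathN (m + 1) :=
  ⟨fun i => μ.1 ⟨i.1, by omega⟩, fun i hi => μ.2 i (by omega)⟩

/-- The conditions on a finite family `{Uᵢ ⊆ E^{nᵢ+1}}` witnessing that `Vset` is a
contracting open set in the sense of Katsura. -/
def ContractingWitness (Vset : Set V) (k : ℕ) (nf : Fin k → ℕ)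
    (U : ∀ i : Fin k, Set (G.PathN (nf i + 1))) : Prop :=
  (∀ i, (U i).Nonempty ∧ IsOpen (U i)) ∧
  (∀ i, ∀ μ ∈ U i, G.pathRange (nf i + 1) μ ∈ Vset) ∧
  (∀ i j, i ≠ j → ∀ h : nf i ≤ nf j, ∀ μ ∈ U j, G.pathTrunc (nf i) (nf j) h μ ∉ U i) ∧
  closure Vset ⊂ ⋃ i, (G.pathSource (nf i + 1)) '' U i

/-- `Vset ⊆ E⁰` is a contracting open set in the sense of Katsura. -/
def IsContractingSet (Vset : Set V) : Prop :=
  Vset.Nonempty ∧ IsOpen Vset ∧ IsCompact (closure Vset) ∧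
    ∃ (k : ℕ) (nf : Fin k → ℕ) (U : ∀ i : Fin k, Set (G.PathN (nf i + 1))),
      G.ContractingWitness Vset k nf U

/-- `E` is contracting at the vertex `v`. -/
def ContractingAt (v : V) : Prop :=
  Dense (G.orb v) ∧ ∀ N : Set V, IsOpen N → v ∈ N →
    ∃ W : Set V, W ⊆ N ∧ G.IsContractingSet W

/-- `E` is a contracting topological graph. -/
def Contracting : Prop := ∃ v : V, G.ContractingAt v

end TopGraph

section

open Set Filter Topology

/-- In a Baire space, if countably many closed sets cover a nonempty open set `U`, then one of
them has an interior point in `U`. -/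
theorem IsOpen.exists_inter_interior_nonempty {X ι : Type*} [TopologicalSpace X] [BaireSpace X]
    [Countable ι] {U : Set X} (hU : IsOpen U) (hne : U.Nonempty) {F : ι → Set X}
    (hF : ∀ i, IsClosed (F i)) (hcov : U ⊆ ⋃ i, F i) : ∃ i, (U ∩ interior (F i)).Nonempty := by
  have hd : Dense (⋃ o : Option ι, interior (o.elim Uᶜ F)) := by
    refine dense_iUnion_interior_of_closed ?_ (eq_univ_of_forall fun x => ?_)
    · rintro (_ | i)
      · exact hU.isClosed_compl
      · exact hF i
    · by_cases hx : x ∈ U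
      · obtain ⟨i, hi⟩ := mem_iUnion.1 (hcov hx)
        exact mem_iUnion.2 ⟨some i, hi⟩
      · exact mem_iUnion.2 ⟨none, hx⟩
  obtain ⟨x, hxU, hx⟩ := hd.inter_open_nonempty U hU hne
  obtain ⟨_ | i, hi⟩ := mem_iUnion.1 hx
  · exact absurd hxU (interior_subset hi)
  · exact ⟨i, x, hxU, hi⟩

/-- A second countable locally compact Hausdorff space is Polish. -/
theorem polishSpace_of_locallyCompactSpace (X : Type*) [TopologicalSpace X]
    [SecondCountableTopology X] [LocallyCompactSpace X] [T2Space X] : PolishSpace X := by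
  let := TopologicalSpace.metrizableSpaceMetric X
  let ι : X → UniformSpace.Completion X := (↑)
  have hι : IsEmbedding ι := (UniformSpace.Completion.isUniformEmbedding_coe X).isEmbedding
  have hopen : IsOpen (range ι) := by
    refine isOpen_iff_mem_nhds.2 ?_
    rintro _ ⟨x, rfl⟩
    obtain ⟨K, hK, hxK⟩ := exists_compact_mem_nhds x
    obtain ⟨O, hO, hOK⟩ := hι.isInducing.isOpen_iff.1 (isOpen_interior (s := K))
    have hmem : ∀ y, ι y ∈ O ↔ y ∈ interior K := fun y => by rw [← hOK]; rfl
    refine mem_of_superset (hO.mem_nhds ((hmem x).2 (mem_interior_iff_mem_nhds.2 hxK))) ?_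
    intro z hz
    by_contra hzr
    have hC : IsClosed (ι '' K) := (hK.image hι.continuous).isClosed
    obtain ⟨_, ⟨hwO, hwK⟩, y, rfl⟩ := UniformSpace.Completion.denseRange_coe.inter_open_nonempty
      (O ∩ (ι '' K)ᶜ) (hO.inter hC.isOpen_compl) ⟨z, hz, fun ⟨y, _, hy⟩ => hzr ⟨y, hy⟩⟩
    exact hwK ⟨y, interior_subset ((hmem y).1 hwO), rfl⟩
  have := hopen.polishSpace
  exact hι.toHomeomorph.isClosedEmbedding.polishSpace

namespace TopGraph

variable {V E : Type} [TopologicalSpace V] [TopologicalSpace E] (G : TopGraph V E)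

/-! ### Boundary paths: shift, extension and existence -/

/-- The infinite boundary path with a given sequence of edges. -/
def mkInf (y : ℕ → E) (hy : ∀ i, G.s (y i) = G.r (y (i + 1))) : G.BoundaryPath :=
  Sum.inl ⟨y, hy⟩

@[simp]
theorem bEdge_mkInf (y : ℕ → E) (hy) (i : ℕ) : G.bEdge (G.mkInf y hy) i = some (y i) := rfl

theorem bEdge_shift (μ : G.BoundaryPath) (i : ℕ) : G.bEdge (G.shift μ) i = G.bEdge μ (i + 1) := by
  rcases μ with y | ⟨⟨_ | _ | n, p⟩, h⟩
  · rfl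
  · rfl
  · simp [bEdge, shift, pathEdge]
  · simp [bEdge, shift, pathEdge, pathTail]

theorem bEdge_iterate_shift (n : ℕ) (μ : G.BoundaryPath) (i : ℕ) :
    G.bEdge (G.shift^[n] μ) i = G.bEdge μ (i + n) := by
  induction n generalizing i with
  | zero => rfl
  | succ n ih => rw [Function.iterate_succ_apply', bEdge_shift, ih]; congr 1; omega

theorem iterate_shift_mkInf (n : ℕ) (y : ℕ → E) (hy) :
    G.shift^[n] (G.mkInf y hy) = G.mkInf (fun i => y (i + n))
      (fun i => by simpa [Nat.add_right_comm] using hy (i + n)) := by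
  induction n generalizing y with
  | zero => rfl
  | succ n ih =>
    rw [Function.iterate_succ_apply]
    exact ih (fun i => y (i + 1)) fun i => hy (i + 1)

theorem bLen_shift {μ : G.BoundaryPath} (h : 1 ≤ G.bLen μ) : G.bLen (G.shift μ) + 1 = G.bLen μ := by
  rcases μ with y | ⟨⟨_ | m, p⟩, hp⟩
  · rfl
  · exact absurd h (by simp [bLen])
  · rfl

theorem bLen_iterate_shift (n : ℕ) (μ : G.BoundaryPath) (h : (n : ℕ∞) ≤ G.bLen μ) :
    G.bLen (G.shift^[n] μ) + n = G.bLen μ := by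
  induction n generalizing μ with
  | zero => simp
  | succ n ih =>
    push_cast at h ⊢
    have h1 := G.bLen_shift (le_add_self.trans h)
    rw [← h1] at h ⊢
    rw [Function.iterate_succ_apply, ← add_assoc,
      ih _ ((ENat.add_le_add_iff_right ENat.one_ne_top).1 h)]

theorem exists_cons (e : E) (β : G.BoundaryPath) (h : G.bRange β = G.s e) :
    ∃ μ, G.bRange μ = G.r e ∧ G.shift μ = β ∧ G.bLen μ = G.bLen β + 1 ∧
      G.bEdge μ 0 = some e := by
  rcases β with y | ⟨⟨_ | n, p⟩, hp⟩
  · refine ⟨Sum.inl ⟨fun i => Nat.casesOn i e y.1, ?_⟩, rfl, rfl, rfl, rfl⟩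
    rintro (_ | i)
    · exact h.symm
    · exact y.2 i
  · obtain rfl : p = G.s e := h
    refine ⟨Sum.inr ⟨⟨1, fun _ => e, fun i hi => absurd hi (by simp)⟩, hp⟩, rfl, rfl, rfl, rfl⟩
  · refine ⟨Sum.inr ⟨⟨n + 2, Fin.cons e p.1, ?_⟩, hp⟩, rfl, rfl, rfl, rfl⟩
    rintro (_ | i) hi
    · exact h.symm
    · exact p.2 i (by omega)

/-- The vertices reached from `S` along an edge of `U 0`, then an edge of `U 1`, and so on,
`n` edges in total. -/
def forward (S : Set V) (U : ℕ → Set E) : ℕ → Set V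
  | 0 => S
  | n + 1 => G.s '' (U n ∩ G.r ⁻¹' forward S U n)

theorem isOpen_forward {S : Set V} (hS : IsOpen S) {U : ℕ → Set E} (hU : ∀ i, IsOpen (U i))
    (n : ℕ) : IsOpen (G.forward S U n) := by
  induction n with
  | zero => exact hS
  | succ n ih =>
    exact G.locHomeo_s.isOpenMap _ ((hU n).inter (ih.preimage G.cont_r))

theorem mem_forward {S : Set V} {U : ℕ → Set E} {y : ℕ → E}
    (hy : ∀ i, G.s (y i) = G.r (y (i + 1))) (h0 : G.r (y 0) ∈ S) (hU : ∀ i, y i ∈ U i) (n : ℕ) :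
    G.r (y n) ∈ G.forward S U n := by
  induction n with
  | zero => exact h0
  | succ n ih => exact ⟨y n, ⟨hU n, ih⟩, hy n⟩

theorem exists_extend {S : Set V} {U : ℕ → Set E} (n : ℕ) (β : G.BoundaryPath)
    (h : G.bRange β ∈ G.forward S U n) :
    ∃ μ, G.bRange μ ∈ S ∧ G.shift^[n] μ = β ∧ G.bLen μ = G.bLen β + n ∧
      ∀ i < n, ∃ e ∈ U i, G.bEdge μ i = some e := by
  induction n generalizing β with
  | zero => exact ⟨β, h, rfl, by simp, by simp⟩
  | succ n ih =>
    obtain ⟨e, ⟨heU, her⟩, hes⟩ := h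
    obtain ⟨γ, hγr, hγs, hγl, hγe⟩ := G.exists_cons e β hes.symm
    obtain ⟨μ, hμr, hμs, hμl, hμe⟩ := ih γ (hγr ▸ her)
    refine ⟨μ, hμr, by rw [Function.iterate_succ_apply', hμs, hγs], ?_, fun i hi => ?_⟩
    · rw [hμl, hγl]; push_cast; ring
    · rcases Nat.lt_succ_iff_lt_or_eq.1 hi with hi | rfl
      · exact hμe i hi
      · refine ⟨e, heU, ?_⟩
        rw [← hγe, ← hμs, bEdge_iterate_shift, zero_add]

theorem mem_range_of_mem_rg [T2Space V] {v : V} (hv : v ∈ G.rg) : v ∈ range G.r := by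
  obtain ⟨⟨N, hNo, hvN, hN⟩, hsce⟩ := hv
  have hcl : v ∈ closure (range G.r) := by
    by_contra h
    exact hsce (subset_closure h)
  by_contra hvr
  have hC : IsClosed (G.r '' (G.r ⁻¹' closure N)) := (hN.image G.cont_r).isClosed
  obtain ⟨_, ⟨hwN, hwC⟩, e, rfl⟩ := mem_closure_iff.1 hcl (N ∩ (G.r '' (G.r ⁻¹' closure N))ᶜ)
    (hNo.inter hC.isOpen_compl) ⟨hvN, fun ⟨e, _, he⟩ => hvr ⟨e, he⟩⟩
  exact hwC ⟨e, subset_closure hwN, rfl⟩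

theorem exists_boundaryPath [T2Space V] (v : V) : ∃ β, G.bRange β = v := by
  by_contra hv
  have step : ∀ w : {w : V // ¬ ∃ β, G.bRange β = w},
      ∃ e, G.r e = w.1 ∧ ¬ ∃ β, G.bRange β = G.s e := by
    rintro ⟨w, hw⟩
    have hwrg : w ∈ G.rg := by
      by_contra h
      exact hw ⟨Sum.inr ⟨⟨0, w⟩, h⟩, rfl⟩
    obtain ⟨e, rfl⟩ := G.mem_range_of_mem_rg hwrg
    refine ⟨e, rfl, fun ⟨β, hβ⟩ => ?_⟩
    obtain ⟨μ, hμ, -⟩ := G.exists_cons e β hβ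
    exact hw ⟨μ, hμ⟩
  choose f hfr hfs using step
  let w : ℕ → {w : V // ¬ ∃ β, G.bRange β = w} :=
    fun n => Nat.rec ⟨v, hv⟩ (fun _ u => ⟨G.s (f u), hfs u⟩) n
  exact hv ⟨Sum.inl ⟨fun i => f (w i), fun i => (hfr (w (i + 1))).symm⟩, hfr (w 0)⟩

theorem exists_mkInf_of_bLen_eq_top {μ : G.BoundaryPath} (h : G.bLen μ = ⊤) :
    ∃ y hy, μ = G.mkInf y hy := by
  rcases μ with ⟨y, hy⟩ | α
  · exact ⟨y, hy, rfl⟩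
  · exact absurd h (ENat.natCast_ne_top _)

theorem exists_mkInf_of_not_trivialIsotropy {μ : G.BoundaryPath} (h : ¬ G.TrivialIsotropy μ) :
    ∃ y hy, μ = G.mkInf y hy ∧ ∃ k p, 0 < p ∧ ∀ i, k ≤ i → y (i + p) = y i := by
  simp only [TrivialIsotropy, not_forall] at h
  obtain ⟨n, ⟨k, l, hn, hk, hl, heq⟩, hn0⟩ := h
  have hkl : k ≠ l := by omega
  have htop : G.bLen μ = ⊤ := by
    by_contra htop
    have h1 := G.bLen_iterate_shift k _ hk
    have h2 := G.bLen_iterate_shift l _ hl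
    rw [heq, ← h2] at h1
    have hne : G.bLen (G.shift^[l] μ) ≠ ⊤ := fun ht => htop (by rw [← h2, ht, top_add])
    exact hkl (by exact_mod_cast ENat.add_right_injective_of_ne_top hne h1)
  obtain ⟨y, hy, rfl⟩ := G.exists_mkInf_of_bLen_eq_top htop
  have hper : ∀ i, y (i + k) = y (i + l) := fun i => by
    simpa [bEdge_iterate_shift] using congrArg (fun β => G.bEdge β i) heq
  refine ⟨y, hy, rfl, ?_⟩
  rcases lt_or_gt_of_ne hkl with hkl | hkl
  · refine ⟨k, l - k, by omega, fun i hi => ?_⟩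
    rw [show i + (l - k) = i - k + l by omega, ← hper, Nat.sub_add_cancel hi]
  · refine ⟨l, k - l, by omega, fun i hi => ?_⟩
    rw [show i + (k - l) = i - l + k by omega, hper, Nat.sub_add_cancel hi]

/-! ### Neighbourhoods of infinite boundary paths -/

/-- The filter of boundary paths whose edges converge to those of the sequence `y`. -/
def edgeFilter (y : ℕ → E) : Filter G.BoundaryPath :=
  comap G.bEdge (Filter.pi fun i => map some (𝓝 (y i)))

theorem tendsto_bEdge (y : ℕ → E) (i : ℕ) :
    Tendsto (fun β => G.bEdge β i) (G.edgeFilter y) (map some (𝓝 (y i))) :=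
  (tendsto_eval_pi (fun i => map some (𝓝 (y i))) i).comp (tendsto_comap (f := G.bEdge))

theorem tendsto_getD_bEdge (y : ℕ → E) :
    Tendsto (fun β i => (G.bEdge β i).getD (y i)) (G.edgeFilter y) (𝓝 y) := by
  refine tendsto_pi_nhds.2 fun i => ?_
  have h2 : Tendsto (fun o : Option E => o.getD (y i)) (map some (𝓝 (y i))) (𝓝 (y i)) :=
    tendsto_map'_iff.2 tendsto_id
  exact h2.comp (G.tendsto_bEdge y i)

theorem eventually_isSome_bEdge (y : ℕ → E) (i : ℕ) :
    ∀ᶠ β in G.edgeFilter y, (G.bEdge β i).isSome := by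
  have h : ∀ᶠ o in map some (𝓝 (y i)), o.isSome :=
    eventually_map.2 (Eventually.of_forall fun _ => rfl)
  exact (G.tendsto_bEdge y i).eventually h

theorem exists_isOpen_of_mem_edgeFilter {y : ℕ → E} {W : Set G.BoundaryPath}
    (hW : W ∈ G.edgeFilter y) :
    ∃ (n : ℕ) (U : ℕ → Set E), (∀ i, IsOpen (U i)) ∧ (∀ i, y i ∈ U i) ∧
      ∀ β, (∀ i < n, ∃ e ∈ U i, G.bEdge β i = some e) → β ∈ W := by
  obtain ⟨T, hT, hTW⟩ := mem_comap.1 hW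
  obtain ⟨I, t, ht, hIt⟩ := mem_pi'.1 hT
  choose U hUt hUo hyU using fun i => mem_nhds_iff.1 (mem_map.1 (ht i))
  refine ⟨I.sup id + 1, U, hUo, hyU, fun β hβ => hTW (hIt fun i hi => ?_)⟩
  obtain ⟨e, he, heq⟩ := hβ i (Nat.lt_succ_of_le (Finset.le_sup (f := id) hi))
  rw [heq]
  exact hUt i he

theorem bRange_eq_of_bEdge_zero {β : G.BoundaryPath} {e : E} (h : G.bEdge β 0 = some e) :
    G.bRange β = G.r e := by
  rcases β with y | ⟨⟨_ | n, p⟩, hp⟩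
  · obtain rfl := Option.some.inj h
    rfl
  · cases h
  · obtain rfl := Option.some.inj h
    rfl

theorem s_eq_r_of_bEdge {β : G.BoundaryPath} {i : ℕ} {e f : E} (he : G.bEdge β i = some e)
    (hf : G.bEdge β (i + 1) = some f) : G.s e = G.r f := by
  rcases β with y | ⟨⟨_ | n, p⟩, hp⟩
  · obtain rfl := Option.some.inj he
    obtain rfl := Option.some.inj hf
    exact y.2 i
  · cases he
  · simp only [bEdge, pathEdge, Option.dite_none_right_eq_some, Option.some.injEq] at he hf
    obtain ⟨_, rfl⟩ := he
    obtain ⟨hi, rfl⟩ := hf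
    exact p.2 i hi

theorem exists_isPrefix (β : G.BoundaryPath) (m : ℕ) (h : ∀ i < m, (G.bEdge β i).isSome) :
    ∃ p : G.PathN m, G.IsPrefix ⟨m, p⟩ β := by
  rcases m with _ | m
  · exact ⟨G.bRange β, rfl, fun i hi => absurd hi (Nat.not_lt_zero i)⟩
  · have hget : ∀ i : Fin (m + 1), G.bEdge β i = some ((G.bEdge β i).get (h i i.2)) :=
      fun i => (Option.some_get _).symm
    refine ⟨⟨fun i => (G.bEdge β i).get (h i i.2),
      fun i hi => G.s_eq_r_of_bEdge (hget ⟨i, by omega⟩) (hget ⟨i + 1, hi⟩)⟩,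
      (G.bRange_eq_of_bEdge_zero (hget 0)).symm, fun i hi => ?_⟩
    have hi' : i < m + 1 := hi
    simp [pathEdge, hi']

theorem eventually_isPrefix_mem {y : ℕ → E} {hy} {U : Set G.FinPath} (hU : IsOpen U) {m : ℕ}
    {p : G.PathN m} (hp : (⟨m, p⟩ : G.FinPath) ∈ U) (hpre : G.IsPrefix ⟨m, p⟩ (G.mkInf y hy)) :
    ∀ᶠ β in G.edgeFilter y, ∀ q : G.PathN m, G.IsPrefix ⟨m, q⟩ β → (⟨m, q⟩ : G.FinPath) ∈ U := by
  have hUm : IsOpen ((fun q : G.PathN m => (⟨m, q⟩ : G.FinPath)) ⁻¹' U) :=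
    isOpen_sigma_iff.1 hU m
  have htend := G.tendsto_getD_bEdge y
  rcases m with _ | m
  · obtain rfl : p = G.r (y 0) := hpre.1
    have hr : Tendsto (fun β => G.r ((G.bEdge β 0).getD (y 0))) (G.edgeFilter y)
        (𝓝 (G.r (y 0))) :=
      (G.cont_r.tendsto _).comp ((tendsto_pi_nhds.1 htend) 0)
    filter_upwards [hr.eventually (hUm.mem_nhds hp), G.eventually_isSome_bEdge y 0] with β h1 h2 q hq
    obtain ⟨e, he⟩ := Option.isSome_iff_exists.1 h2
    obtain rfl : q = G.r e := hq.1.trans (G.bRange_eq_of_bEdge_zero he)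
    rw [he] at h1
    exact h1
  · obtain ⟨O, hO, hOU⟩ := isOpen_induced_iff.1 hUm
    have hmem : ∀ q : G.PathN (m + 1), q.1 ∈ O ↔ (⟨m + 1, q⟩ : G.FinPath) ∈ U :=
      fun q => Set.ext_iff.1 hOU q
    have hedge : ∀ (β : G.BoundaryPath) (q : G.PathN (m + 1)), G.IsPrefix ⟨m + 1, q⟩ β →
        (fun i : Fin (m + 1) => (G.bEdge β i).getD (y i)) = q.1 := by
      intro β q hq
      funext i
      rw [hq.2 i i.2]
      change (G.pathEdge (m + 1) q i).getD _ = _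
      rw [pathEdge, dif_pos i.2]
      rfl
    have hlim : Tendsto (fun β => fun i : Fin (m + 1) => (G.bEdge β i).getD (y i))
        (G.edgeFilter y) (𝓝 p.1) := by
      rw [← hedge _ p hpre]
      exact tendsto_pi_nhds.2 fun i => tendsto_pi_nhds.1 htend i
    filter_upwards [hlim.eventually (hO.mem_nhds ((hmem p).2 hp))] with β hβ q hq
    rw [hedge β q hq] at hβ
    exact (hmem q).1 hβ

instance [T2Space V] [T2Space E] : T2Space G.FinPath := by
  have : ∀ n, T2Space (G.PathN n) := by
    rintro (_ | n)
    · exact inferInstanceAs (T2Space V)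
    · exact inferInstanceAs (T2Space { μ : Fin (n + 1) → E // G.PathCond (n + 1) μ })
  exact inferInstanceAs (T2Space ((n : ℕ) × G.PathN n))

theorem edgeFilter_le_nhds [T2Space V] [T2Space E] (y : ℕ → E) (hy) :
    G.edgeFilter y ≤ 𝓝 (G.mkInf y hy) := by
  rw [TopologicalSpace.nhds_generateFrom]
  refine le_iInf₂ fun W hW => le_principal_iff.2 ?_
  obtain ⟨hyW, U, K, hU, hK, rfl⟩ := hW
  obtain ⟨⟨⟨m, p⟩, hpU, hpre⟩, hyK⟩ := hyW
  have hfst : Continuous (Sigma.fst : G.FinPath → ℕ) :=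
    continuous_sigma fun n => (continuous_const : Continuous fun _ : G.PathN n => n)
  have hfin : (Sigma.fst '' K : Set ℕ).Finite := (hK.image hfst).finite_of_discrete
  have hKev : ∀ᶠ β in G.edgeFilter y, ∀ n ∈ (Sigma.fst '' K : Set ℕ), ∀ q : G.PathN n,
      G.IsPrefix ⟨n, q⟩ β → (⟨n, q⟩ : G.FinPath) ∈ Kᶜ := by
    refine (eventually_all_finite hfin).2 fun n _ => ?_
    obtain ⟨q, hq⟩ := G.exists_isPrefix (G.mkInf y hy) n fun i _ => rfl
    exact G.eventually_isPrefix_mem hK.isClosed.isOpen_compl (fun h => hyK ⟨_, h, hq⟩) hq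
  have hsome : ∀ᶠ β in G.edgeFilter y, ∀ i ∈ {i | i < m}, (G.bEdge β i).isSome :=
    (eventually_all_finite (finite_lt_nat m)).2 fun i _ => G.eventually_isSome_bEdge y i
  filter_upwards [G.eventually_isPrefix_mem hU hpU hpre, hsome, hKev] with β h1 h2 h3
  obtain ⟨q, hq⟩ := G.exists_isPrefix β m h2
  exact ⟨⟨_, h1 q hq, hq⟩, fun ⟨⟨n, q'⟩, hq'K, hq'⟩ => h3 n ⟨_, hq'K, rfl⟩ q' hq' hq'K⟩

/-! ### Topologically free graphs are essentially free -/

theorem exists_cycle_of_periodic {y : ℕ → E} (hy : ∀ i, G.s (y i) = G.r (y (i + 1))) {p : ℕ}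
    (hp : 0 < p) (hper : ∀ i, y (i + p) = y i) (hent : ∀ i e, G.r e = G.r (y i) → e = y i) :
    ∃ (n : ℕ) (μ : G.PathN (n + 1)),
      G.IsCycle n μ ∧ G.NoEntrances n μ ∧ G.pathRange (n + 1) μ = G.r (y 0) := by
  obtain ⟨n, rfl⟩ := Nat.exists_eq_succ_of_ne_zero hp.ne'
  refine ⟨n, ⟨fun i => y i, fun i _ => hy i⟩, ?_, fun i e he => hent i e he, rfl⟩
  change G.r (y 0) = G.s (y n)
  rw [hy, ← hper 0, zero_add]

theorem exists_cycle_of_forall_periodic [T2Space V] {v : V} {p : ℕ} (hp : 0 < p)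
    (h : ∀ β, G.bRange β = v → ∃ y hy, β = G.mkInf y hy ∧ ∀ i, y (i + p) = y i) :
    ∃ (n : ℕ) (μ : G.PathN (n + 1)),
      G.IsCycle n μ ∧ G.NoEntrances n μ ∧ G.pathRange (n + 1) μ = v := by
  obtain ⟨β, rfl⟩ := G.exists_boundaryPath v
  obtain ⟨y, hy, rfl, hper⟩ := h _ rfl
  refine G.exists_cycle_of_periodic hy hp hper fun i e (he : G.r e = G.r (y i)) => ?_
  obtain ⟨γ, hγ⟩ := G.exists_boundaryPath (G.s e)
  obtain ⟨δ, hδr, -, -, hδe⟩ := G.exists_cons e γ hγ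
  have hδ : G.bRange δ ∈ G.forward {G.r (y 0)} (fun j => {y j}) (i + p) := by
    rw [hδr, he, ← hper i]
    exact G.mem_forward hy (mem_singleton _) (fun _ => mem_singleton _) _
  obtain ⟨μ, hμr, rfl, -, hμe⟩ := G.exists_extend (i + p) δ hδ
  obtain ⟨z, hz, rfl, hzper⟩ := h μ hμr
  obtain ⟨e', rfl, hi⟩ := hμe i (by omega)
  rw [bEdge_iterate_shift, zero_add, bEdge_mkInf, hzper] at hδe
  exact Option.some.inj (hδe.symm.trans hi)

theorem isClosed_setOf_path [T2Space V] :
    IsClosed {y : ℕ → E | ∀ i, G.s (y i) = G.r (y (i + 1))} := by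
  simp only [ofPred_forall]
  exact isClosed_iInter fun i => isClosed_eq
    (G.locHomeo_s.continuous.comp (continuous_apply i)) (G.cont_r.comp (continuous_apply (i + 1)))

theorem exists_isOpen_forall_periodic [SecondCountableTopology E] [LocallyCompactSpace E]
    [T2Space V] [T2Space E] {O : Set V} (hO : IsOpen O) (hne : O.Nonempty)
    (h : ∀ β, G.bRange β ∈ O →
      ∃ y hy, β = G.mkInf y hy ∧ ∃ k p, 0 < p ∧ ∀ i, k ≤ i → y (i + p) = y i) :
    ∃ (S : Set V) (p : ℕ), IsOpen S ∧ S.Nonempty ∧ 0 < p ∧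
      ∀ β, G.bRange β ∈ S → ∃ y hy, β = G.mkInf y hy ∧ ∀ i, y (i + p) = y i := by
  have := polishSpace_of_locallyCompactSpace E
  let X := {y : ℕ → E | ∀ i, G.s (y i) = G.r (y (i + 1))}
  have : PolishSpace X := G.isClosed_setOf_path.polishSpace
  let := TopologicalSpace.upgradeIsCompletelyMetrizable X
  let F : ℕ × ℕ → Set X := fun q => {y | ∀ i, q.1 ≤ i → y.1 (i + (q.2 + 1)) = y.1 i}
  have hev : ∀ i, Continuous fun y : X => y.1 i :=
    fun i => (continuous_apply i).comp continuous_subtype_val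
  have hF : ∀ q, IsClosed (F q) := fun q => by
    simp only [F, ofPred_forall]
    exact isClosed_iInter fun i => isClosed_iInter fun _ => isClosed_eq (hev _) (hev _)
  obtain ⟨v, hv⟩ := hne
  obtain ⟨β, rfl⟩ := G.exists_boundaryPath v
  obtain ⟨x, hx, rfl, -⟩ := h β hv
  obtain ⟨⟨k, p⟩, ⟨y, hy⟩, hyO, hyF⟩ :=
    (hO.preimage (G.cont_r.comp (hev 0))).exists_inter_interior_nonempty ⟨⟨x, hx⟩, hv⟩ hF
      fun y hyO => by
        obtain ⟨z, hz, hyz, k, p, hp, hper⟩ := h (G.mkInf y.1 y.2) hyO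
        obtain rfl : y = ⟨z, hz⟩ := Sum.inl.inj hyz
        refine mem_iUnion.2 ⟨(k, p - 1), fun i hi => ?_⟩
        rw [Nat.sub_add_cancel hp]
        exact hper i hi
  obtain ⟨T, hT, hTF⟩ := isOpen_induced_iff.1 (isOpen_interior (s := F (k, p)))
  obtain ⟨I, u, hu, huT⟩ := isOpen_pi_iff.1 hT y (by rw [← hTF] at hyF; exact hyF)
  classical
  let U : ℕ → Set E := fun i => if i ∈ I then u i else univ
  have hU : ∀ i, IsOpen (U i) := fun i => by
    by_cases hi : i ∈ I <;> simp [U, hi, (hu i _).1]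
  have hyU : ∀ i, y i ∈ U i := fun i => by
    by_cases hi : i ∈ I <;> simp [U, hi, (hu i _).2]
  let n := max k (I.sup id + 1)
  refine ⟨G.forward O U n, p + 1, G.isOpen_forward hO hU n, ⟨_, G.mem_forward hy hyO hyU n⟩,
    Nat.succ_pos p, fun β hβ => ?_⟩
  obtain ⟨μ, hμO, rfl, -, hμU⟩ := G.exists_extend n β hβ
  obtain ⟨z, hz, rfl, -⟩ := h μ hμO
  refine ⟨_, _, G.iterate_shift_mkInf n z hz, fun i => ?_⟩
  have hzT : z ∈ T := huT fun j hj => by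
    have hjn : j < n := lt_max_of_lt_right (Nat.lt_succ_of_le (Finset.le_sup (f := id) hj))
    obtain ⟨e, he, hze⟩ := hμU j hjn
    obtain rfl := Option.some.inj hze
    simpa [U, Finset.mem_coe.1 hj] using he
  have hzF : (⟨z, hz⟩ : X) ∈ F (k, p) := interior_subset (hTF ▸ hzT)
  rw [Nat.add_right_comm]
  exact hzF (i + n) (le_add_left (le_max_left k _))

theorem TopologicallyFree.essentiallyFree [SecondCountableTopology E] [LocallyCompactSpace E]
    [T2Space V] [T2Space E] (h : G.TopologicallyFree) : G.EssentiallyFree := by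
  refine dense_iff_inter_open.2 fun W hW ⟨μ, hμ⟩ => ?_
  by_contra hcon
  have hiso : ∀ β ∈ W, ¬ G.TrivialIsotropy β := fun β hβ hβt => hcon ⟨β, hβ, hβt⟩
  obtain ⟨x, hx, rfl, -⟩ := G.exists_mkInf_of_not_trivialIsotropy (hiso μ hμ)
  obtain ⟨n, U, hU, hxU, hUW⟩ :=
    G.exists_isOpen_of_mem_edgeFilter (G.edgeFilter_le_nhds x hx (hW.mem_nhds hμ))
  obtain ⟨S, p, hS, ⟨v, hv⟩, hp, hper⟩ := G.exists_isOpen_forall_periodic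
    (G.isOpen_forward isOpen_univ hU n) ⟨_, G.mem_forward hx (mem_univ _) hxU n⟩ fun β hβ => by
      obtain ⟨μ, -, rfl, -, hμU⟩ := G.exists_extend n β hβ
      obtain ⟨y, hy, rfl, k, p, hp, hper⟩ :=
        G.exists_mkInf_of_not_trivialIsotropy (hiso μ (hUW μ hμU))
      refine ⟨_, _, G.iterate_shift_mkInf n y hy, k, p, hp, fun i hi => ?_⟩
      rw [Nat.add_right_comm]
      exact hper (i + n) (le_add_right hi)
  refine (h ▸ notMem_empty v : v ∉ interior _) (mem_interior.2 ⟨S, fun w hw => ?_, hS, hv⟩)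
  exact G.exists_cycle_of_forall_periodic hp fun β hβ => hper β (hβ ▸ hw)

/-! ### Essentially free graphs are topologically free -/

theorem IsCycle.exists_periodic {n : ℕ} {μ : G.PathN (n + 1)} (hμ : G.IsCycle n μ)
    (hent : G.NoEntrances n μ) :
    ∃ y : ℕ → E, G.r (y 0) = G.pathRange (n + 1) μ ∧ (∀ i, G.s (y i) = G.r (y (i + 1))) ∧
      (∀ i, y (i + (n + 1)) = y i) ∧ ∀ i e, G.r e = G.r (y i) → e = y i := by
  have hpos : 0 < n + 1 := Nat.succ_pos n
  refine ⟨fun i => μ.1 ⟨i % (n + 1), Nat.mod_lt i hpos⟩, rfl, fun i => ?_, fun i => ?_,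
    fun i e => hent _ e⟩
  · have hlt := Nat.mod_lt i hpos
    by_cases hi : i % (n + 1) + 1 < n + 1
    · have h1 : (i + 1) % (n + 1) = i % (n + 1) + 1 := by
        rw [← Nat.mod_add_mod, Nat.mod_eq_of_lt hi]
      simp only [h1]
      exact μ.2 _ hi
    · have h0 : i % (n + 1) = n := by omega
      have h1 : (i + 1) % (n + 1) = 0 := by
        rw [← Nat.mod_add_mod, h0, Nat.mod_self]
      simp only [h0, h1]
      exact Eq.symm hμ
  · simp only [Nat.add_mod_right]

theorem path_unique {x y : ℕ → E} (hx : ∀ i, G.s (x i) = G.r (x (i + 1)))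
    (hent : ∀ i e, G.r e = G.r (x i) → e = x i) (hy : ∀ i, G.s (y i) = G.r (y (i + 1)))
    (h0 : G.r (y 0) = G.r (x 0)) : y = x := by
  funext i
  induction i with
  | zero => exact hent 0 _ h0
  | succ i ih => exact hent _ _ (by rw [← hy, ← hx, ih])

/-- The vertices from which there is an infinite path of period `p` with edges in `L`. -/
def periodicRange (p : ℕ) (L : Set E) : Set V :=
  {w | ∃ x : ℕ → E, G.r (x 0) = w ∧ (∀ i, G.s (x i) = G.r (x (i + 1))) ∧
    (∀ i, x (i + p) = x i) ∧ ∀ i, x i ∈ L}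

/-- The vertices from which there is an infinite path of period `p` with edges in `L` and
without entrances. -/
def isolatedPeriodicRange (p : ℕ) (L : Set E) : Set V :=
  {w | ∃ x : ℕ → E, G.r (x 0) = w ∧ (∀ i, G.s (x i) = G.r (x (i + 1))) ∧
    (∀ i, x (i + p) = x i) ∧ (∀ i, x i ∈ L) ∧ ∀ i e, G.r e = G.r (x i) → e = x i}

theorem isCompact_periodicRange [T2Space V] [T2Space E] (p : ℕ) {L : Set E} (hL : IsCompact L) :
    IsCompact (G.periodicRange p L) := by
  have hper : IsClosed {x : ℕ → E | ∀ i, x (i + p) = x i} := by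
    simp only [ofPred_forall]
    exact isClosed_iInter fun i => isClosed_eq (continuous_apply _) (continuous_apply i)
  have hK := ((isCompact_univ_pi fun _ : ℕ => hL).inter_right
    (G.isClosed_setOf_path.inter hper)).image (G.cont_r.comp (continuous_apply 0))
  convert hK using 1
  ext w
  constructor
  · rintro ⟨x, h0, hx, hp, hxL⟩
    exact ⟨x, ⟨fun i _ => hxL i, hx, hp⟩, h0⟩
  · rintro ⟨x, ⟨hxL, hx, hp⟩, h0⟩
    exact ⟨x, h0, hx, hp, fun i => hxL i (mem_univ i)⟩

theorem exists_isOpen_subset_isolatedPeriodicRange [SecondCountableTopology E]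
    [LocallyCompactSpace V] [LocallyCompactSpace E] [T2Space V] [T2Space E]
    (h : ¬ G.TopologicallyFree) :
    ∃ (U : Set V) (p : ℕ) (L : Set E), IsOpen U ∧ U.Nonempty ∧ 0 < p ∧ IsCompact L ∧
      U ⊆ G.isolatedPeriodicRange p L := by
  have hex : ∀ v ∈ interior {v : V | ∃ (n : ℕ) (μ : G.PathN (n + 1)),
      G.IsCycle n μ ∧ G.NoEntrances n μ ∧ G.pathRange (n + 1) μ = v},
      ∃ (n : ℕ) (y : ℕ → E), G.r (y 0) = v ∧ (∀ i, G.s (y i) = G.r (y (i + 1))) ∧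
        (∀ i, y (i + (n + 1)) = y i) ∧ ∀ i e, G.r e = G.r (y i) → e = y i := by
    intro v hv
    obtain ⟨n, μ, hμ, hent, rfl⟩ := interior_subset hv
    exact ⟨n, hμ.exists_periodic G hent⟩
  obtain ⟨⟨n, j⟩, hne⟩ := isOpen_interior.exists_inter_interior_nonempty
    (nonempty_iff_ne_empty.2 h) (F := fun q : ℕ × ℕ =>
      G.periodicRange (q.1 + 1) (compactCovering E q.2))
    (fun q => (G.isCompact_periodicRange _ (isCompact_compactCovering E _)).isClosed)
    fun v hv => by
      obtain ⟨n, y, h0, hy, hper, -⟩ := hex v hv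
      choose c hc using fun i => mem_iUnion.1 (iUnion_compactCovering E ▸ mem_univ (y i))
      refine mem_iUnion.2 ⟨(n, (Finset.range (n + 1)).sup c), y, h0, hy, hper, fun i => ?_⟩
      have hmod : ∀ i, y i = y (i % (n + 1)) := fun i => (Function.Periodic.map_mod_nat hper i).symm
      rw [hmod]
      exact compactCovering_subset E (Finset.le_sup
        (Finset.mem_range.2 (Nat.mod_lt i (Nat.succ_pos n)))) (hc _)
  refine ⟨_, n + 1, compactCovering E j, isOpen_interior.inter isOpen_interior, hne,
    Nat.succ_pos n, isCompact_compactCovering E j, ?_⟩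
  rintro v ⟨hv, hvF⟩
  obtain ⟨x, rfl, hx, hper, hxL⟩ := interior_subset hvF
  obtain ⟨m, y, h0, hy, -, hent⟩ := hex _ hv
  obtain rfl := G.path_unique hy hent hx h0.symm
  exact ⟨x, rfl, hx, hper, hxL, hent⟩

theorem s_mem_isolatedPeriodicRange {p : ℕ} {L : Set E} {e : E}
    (he : G.r e ∈ G.isolatedPeriodicRange p L) : G.s e ∈ G.isolatedPeriodicRange p L := by
  obtain ⟨x, h0, hx, hper, hxL, hent⟩ := he
  obtain rfl := hent 0 e h0.symm
  refine ⟨fun i => x (i + 1), (hx 0).symm, fun i => hx (i + 1), fun i => ?_,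
    fun i => hxL (i + 1), fun i => hent (i + 1)⟩
  change x (i + p + 1) = x (i + 1)
  rw [Nat.add_right_comm, hper]

theorem mem_rg_of_subset_isolatedPeriodicRange [LocallyCompactSpace V] [T2Space V] {p : ℕ}
    {L : Set E} (hL : IsCompact L) {W : Set V} (hW : IsOpen W)
    (hWL : W ⊆ G.isolatedPeriodicRange p L) {w : V} (hw : w ∈ W) : w ∈ G.rg := by
  constructor
  · obtain ⟨N, hN, hwN, hNW⟩ := exists_compact_subset hW hw
    refine ⟨interior N, isOpen_interior, hwN, ?_⟩
    refine hL.of_isClosed_subset (isClosed_closure.preimage G.cont_r) fun e he => ?_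
    obtain ⟨x, h0, -, -, hxL, hent⟩ :=
      hWL (hNW (closure_minimal interior_subset hN.isClosed he))
    rw [hent 0 e h0.symm]
    exact hxL 0
  · intro hcl
    obtain ⟨u, huW, hu⟩ := mem_closure_iff.1 hcl W hW hw
    obtain ⟨x, h0, -⟩ := hWL huW
    exact hu (subset_closure ⟨x 0, h0⟩)

theorem pathSource_mem_rg [LocallyCompactSpace V] [T2Space V] {p : ℕ} {L : Set E}
    (hL : IsCompact L) (m : ℕ) (q : G.PathN m) {W : Set V} (hW : IsOpen W)
    (hWL : W ⊆ G.isolatedPeriodicRange p L) (hq : G.pathRange m q ∈ W) :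
    G.pathSource m q ∈ G.rg := by
  induction m generalizing W with
  | zero => exact G.mem_rg_of_subset_isolatedPeriodicRange hL hW hWL hq
  | succ m ih =>
    rw [← G.pathSource_pathTail]
    refine ih (G.pathTail m q) (G.locHomeo_s.isOpenMap _ (hW.preimage G.cont_r)) ?_
      ⟨q.1 0, hq, ?_⟩
    · rintro _ ⟨e, he, rfl⟩
      exact G.s_mem_isolatedPeriodicRange (hWL he)
    · rcases m with _ | m
      · rfl
      · exact q.2 0 (by omega)

theorem not_trivialIsotropy_of_periodic {y : ℕ → E} (hy : ∀ i, G.s (y i) = G.r (y (i + 1))) {p : ℕ}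
    (hp : 0 < p) (hper : ∀ i, y (i + p) = y i) : ¬ G.TrivialIsotropy (G.mkInf y hy) := by
  intro h
  have hp0 := h p ⟨p, 0, by simp, le_top, le_top, by
    rw [iterate_shift_mkInf]
    exact congrArg Sum.inl (Subtype.ext (funext hper))⟩
  omega

theorem EssentiallyFree.topologicallyFree [SecondCountableTopology E] [LocallyCompactSpace V]
    [LocallyCompactSpace E] [T2Space V] [T2Space E] (h : G.EssentiallyFree) :
    G.TopologicallyFree := by
  by_contra htop
  obtain ⟨U, p, L, hU, ⟨v, hv⟩, hp, hL, hUL⟩ := G.exists_isOpen_subset_isolatedPeriodicRange htop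
  let S : Set G.FinPath := {α | α.1 = 0 ∧ G.pathRange α.1 α.2 ∈ U}
  have hS : IsOpen S := by
    refine isOpen_sigma_iff.2 ?_
    rintro (_ | m)
    · have h0 : IsOpen {w : V | 0 = 0 ∧ w ∈ U} := by simpa using hU
      exact h0
    · convert isOpen_empty
      exact eq_empty_of_forall_notMem fun q hq => Nat.succ_ne_zero m hq.1
  have hopen : IsOpen (G.cyl S) := by
    refine TopologicalSpace.isOpen_generateFrom_of_mem ⟨S, ∅, hS, isCompact_empty, ?_⟩
    have : G.cyl ∅ = ∅ := eq_empty_of_forall_notMem fun _ ⟨_, hα, _⟩ => hα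
    rw [this, compl_empty, inter_univ]
  obtain ⟨β, hβ⟩ := G.exists_boundaryPath v
  have hne : (G.cyl S).Nonempty :=
    ⟨β, ⟨0, v⟩, ⟨rfl, hv⟩, hβ.symm, fun i hi => absurd hi (Nat.not_lt_zero i)⟩
  obtain ⟨μ, ⟨⟨m, q⟩, ⟨-, hqU⟩, hqμ, -⟩, hμ⟩ := h.inter_open_nonempty _ hopen hne
  have hμU : G.bRange μ ∈ U := hqμ ▸ hqU
  rcases μ with ⟨y, hy⟩ | ⟨⟨k, a⟩, ha⟩
  · obtain ⟨x, h0, hx, hper, -, hent⟩ := hUL hμU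
    obtain rfl := G.path_unique hx hent hy h0.symm
    exact G.not_trivialIsotropy_of_periodic hy hp hper hμ
  · exact ha (G.pathSource_mem_rg hL k a hU hUL hμU)

end TopGraph

end

/-- Proposition 3.7: a topological graph `E` is topologically free iff
it is essentially free (the units of the boundary path groupoid `Γ(∂E, σ)` with trivial
isotropy are dense in `∂E`). -/
theorem TopGraph.topologicallyFree_iff_essentiallyFree {V E : Type}
    [TopologicalSpace V] [TopologicalSpace E]
    [SecondCountableTopology V] [SecondCountableTopology E]
    [LocallyCompactSpace V] [LocallyCompactSpace E] [T2Space V] [T2Space E]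
    (G : TopGraph V E) :
    G.TopologicallyFree ↔ G.EssentiallyFree := by
  exact ⟨fun h => h.essentiallyFree, fun h => h.topologicallyFree⟩
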